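/- arXiv:1603.04049 — 12 statements merged into one kernel-verified Lean document; each statement's English description precedes it below -/
import Mathlib

section
/- Let (X,d) be a metric space and k a positive integer. (i) If dim_k(X) < +∞ then dim_k(X) < dim_{k+1}(X). (ii) If dim_k(X) = +∞ then dim_{k+1}(X) = +∞. -/
open Set

/-- `S ⊆ X` is a `k`-metric generator for the distance function `ρ` on `X`:
every pair of distinct points of `X` is distinguished by at least `k` points of `S`. -/
def IsKMetricGenerator {X α : Type*} (ρ : X → X → α) (k : ℕ) (S : Set X) : Prop :=
  ∀ u v : X, u ≠ v → (k : ℕ∞) ≤ {w ∈ S | ρ u w ≠ ρ v w}.encard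

/-- The `k`-metric dimension of `X` with respect to the distance function `ρ`:
the infimum of the cardinalities of finite `k`-metric generators, `⊤` if none exists. -/
noncomputable def kMetricDim {X α : Type*} (ρ : X → X → α) (k : ℕ) : ℕ∞ :=
  sInf {n : ℕ∞ | ∃ S : Finset X, IsKMetricGenerator ρ k ↑S ∧ n = S.card}

/-- Removing one point from a `(k + 1)`-metric generator leaves a `k`-metric generator. -/
theorem IsKMetricGenerator.diff_singleton {X α : Type*} {ρ : X → X → α} {k : ℕ} {S : Set X}
    (hS : IsKMetricGenerator ρ (k + 1) S) (a : X) : IsKMetricGenerator ρ k (S \ {a}) := by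
  intro u v huv
  have hsub : {w ∈ S | ρ u w ≠ ρ v w} ⊆ insert a {w ∈ S \ {a} | ρ u w ≠ ρ v w} := by
    rintro w ⟨hwS, hw⟩
    by_cases hwa : w = a
    · exact Or.inl hwa
    · exact Or.inr ⟨⟨hwS, hwa⟩, hw⟩
  have h : (k : ℕ∞) + 1 ≤ {w ∈ S \ {a} | ρ u w ≠ ρ v w}.encard + 1 := by
    exact_mod_cast ((hS u v huv).trans (encard_le_encard hsub)).trans (encard_insert_le _ _)
  exact (ENat.add_le_add_iff_right ENat.one_ne_top).1 h

/-- On a space with at least two points, a `(k + 1)`-metric generator is nonempty. -/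
theorem IsKMetricGenerator.nonempty {X α : Type*} [Nontrivial X] {ρ : X → X → α} {k : ℕ}
    {S : Set X} (hS : IsKMetricGenerator ρ (k + 1) S) : S.Nonempty := by
  obtain ⟨u, v, huv⟩ := exists_pair_ne X
  have hpos : (0 : ℕ∞) < ((k + 1 : ℕ) : ℕ∞) := by exact_mod_cast k.succ_pos
  obtain ⟨w, hw, -⟩ := encard_pos.1 (hpos.trans_le (hS u v huv))
  exact ⟨w, hw⟩

theorem kMetricDim_add_one_le {X α : Type*} [Nontrivial X] (ρ : X → X → α) (k : ℕ) :
    kMetricDim ρ k + 1 ≤ kMetricDim ρ (k + 1) := by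
  classical
  refine le_sInf ?_
  rintro _ ⟨S, hS, rfl⟩
  obtain ⟨a, ha⟩ := hS.nonempty
  have hle : kMetricDim ρ k ≤ (S.erase a).card :=
    sInf_le ⟨S.erase a, by simpa using hS.diff_singleton a, rfl⟩
  calc kMetricDim ρ k + 1 ≤ ((S.erase a).card : ℕ∞) + 1 := by gcongr
    _ = S.card := by exact_mod_cast Finset.card_erase_add_one ha

/-- For a metric space `X` (with at least three points) and `k ≥ 1`:
(i) if `dim_k(X) < ∞` then `dim_k(X) < dim_{k+1}(X)`;
(ii) if `dim_k(X) = ∞` then `dim_{k+1}(X) = ∞`. -/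
theorem kMetricDim_strict_mono {X : Type*} [MetricSpace X]
    (hX : ∃ a b c : X, a ≠ b ∧ a ≠ c ∧ b ≠ c) (k : ℕ) (hk : 1 ≤ k) :
    (kMetricDim (fun x y : X => dist x y) k < ⊤ →
      kMetricDim (fun x y : X => dist x y) k <
        kMetricDim (fun x y : X => dist x y) (k + 1)) ∧
    (kMetricDim (fun x y : X => dist x y) k = ⊤ →
      kMetricDim (fun x y : X => dist x y) (k + 1) = ⊤) := by
  obtain ⟨a, b, -, hab, -, -⟩ := hX
  have : Nontrivial X := ⟨a, b, hab⟩
  have h := kMetricDim_add_one_le (fun x y : X => dist x y) k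
  refine ⟨fun hlt => ?_, fun htop => ?_⟩
  · exact (ENat.add_one_le_iff hlt.ne).1 h
  · simpa [htop] using h
end

section
/- Let (X,d) be a metric space. If X is the union of an increasing sequence B_1 ⊆ B_2 ⊆ B_3 ⊆ ... of bisectors (i.e., each B_n = B(u_n|v_n) for some distinct u_n, v_n ∈ X), then dim_1(X) = +∞. -/
open Set

/-- If a metric space `X` (with at least three points) is the union of an
increasing sequence of bisectors, then `dim_1(X) = ∞`. -/
theorem kMetricDim_one_eq_top_of_iUnion_bisectors {X : Type*} [MetricSpace X]
    (hX : ∃ a b c : X, a ≠ b ∧ a ≠ c ∧ b ≠ c)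
    (u v : ℕ → X) (huv : ∀ n, u n ≠ v n)
    (hmono : ∀ n, {x : X | dist x (u n) = dist x (v n)} ⊆
      {x : X | dist x (u (n + 1)) = dist x (v (n + 1))})
    (hunion : (⋃ n, {x : X | dist x (u n) = dist x (v n)}) = Set.univ) :
    kMetricDim (fun x y : X => dist x y) 1 = ⊤ := by
  refine sInf_eq_top.2 ?_
  rintro _ ⟨S, hS, -⟩
  have hB := monotone_nat_of_le_succ hmono
  have hmem : ∀ x : X, ∃ n, dist x (u n) = dist x (v n) := fun x => by
    simpa using hunion.ge (Set.mem_univ x)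
  choose f hf using hmem
  have hempty : {w ∈ (S : Set X) |
      dist (u (S.sup f)) w ≠ dist (v (S.sup f)) w} = ∅ := by
    rw [Set.eq_empty_iff_forall_notMem]
    rintro w ⟨hw, hne⟩
    have h : dist w (u (S.sup f)) = dist w (v (S.sup f)) := hB (Finset.le_sup hw) (hf w)
    exact hne (by rwa [dist_comm _ w, dist_comm _ w])
  have h := hS _ _ (huv (S.sup f))
  simp only [hempty] at h
  simp at h
end

section
/- Let (X,d) be a compact metric space with dim_1(X) = m < +∞. Then X is homeomorphic to a compact subset of ℝ^m; more precisely, if {x_1,...,x_m} is a 1-metric generator of cardinality m, then the map Δ : X → ℝ^m given by Δ(x) = (d(x,x_1),...,d(x,x_m)) is continuous, injective, and a homeomorphism onto its (compact) image. -/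
open Set

/-- Let `X` be a compact metric space (with at least three points) with
`dim_1(X) = m < ∞`, and let `x_1, …, x_m` be a `1`-metric generator of cardinality `m`.
Then the map `Δ : X → ℝ^m`, `Δ(p) = (d(p,x_1), …, d(p,x_m))`, is continuous, injective,
has compact image, and is a homeomorphism onto its image (an embedding); in particular
`X` is homeomorphic to a compact subset of `ℝ^m`. -/
theorem compact_embeds_in_euclidean {X : Type*} [MetricSpace X] [CompactSpace X]
    (hX : ∃ a b c : X, a ≠ b ∧ a ≠ c ∧ b ≠ c)
    (m : ℕ) (hdim : kMetricDim (fun x y : X => dist x y) 1 = (m : ℕ∞))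
    (x : Fin m → X) (hinj : Function.Injective x)
    (hgen : IsKMetricGenerator (fun x y : X => dist x y) 1 (Set.range x)) :
    Continuous (fun p : X => fun i : Fin m => dist p (x i)) ∧
    Function.Injective (fun p : X => fun i : Fin m => dist p (x i)) ∧
    IsCompact (Set.range (fun p : X => fun i : Fin m => dist p (x i))) ∧
    Topology.IsEmbedding (fun p : X => fun i : Fin m => dist p (x i)) := by
  have hc : Continuous (fun p : X => fun i : Fin m => dist p (x i)) := by fun_prop
  have hi : Function.Injective (fun p : X => fun i : Fin m => dist p (x i)) := by
    intro u v huv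
    by_contra hne
    have h1 := hgen u v hne
    rw [Nat.cast_one, Set.one_le_encard_iff_nonempty] at h1
    obtain ⟨w, ⟨i, rfl⟩, hw⟩ := h1
    exact hw (congrFun huv i)
  exact ⟨hc, hi, isCompact_range hc, (hc.isClosedEmbedding hi).isEmbedding⟩
end

section
/- If X is an arcwise (path-)connected metric space with dim_1(X) = 1, then X is a Jordan arc; that is, X is homeomorphic to the real interval [0,1] or to the real interval [0,+∞). -/
open Set

/-- A space of `1`-metric dimension one has a point that is determined by the distances to it. -/
lemma exists_dist_injective_of_kMetricDim_one {X : Type*} [MetricSpace X] [Nontrivial X]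
    (hdim : kMetricDim (fun x y : X => dist x y) 1 = 1) :
    ∃ p : X, Function.Injective fun x => dist x p := by
  have hne : {n : ℕ∞ | ∃ S : Finset X,
      IsKMetricGenerator (fun x y : X => dist x y) 1 ↑S ∧ n = S.card}.Nonempty := by
    by_contra h
    rw [Set.not_nonempty_iff_eq_empty] at h
    simp [kMetricDim, h] at hdim
  obtain ⟨S, hS, hcard⟩ := csInf_mem hne
  have hS1 : S.card = 1 := by exact_mod_cast hcard.symm.trans hdim
  obtain ⟨p, rfl⟩ := Finset.card_eq_one.mp hS1
  refine ⟨p, fun u v huv => by_contra fun hne => ?_⟩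
  have hpos : {w ∈ (↑({p} : Finset X) : Set X) | dist u w ≠ dist v w}.encard ≠ 0 := by
    intro h0
    have h1 := hS u v hne
    simp only [h0] at h1
    simp at h1
  obtain ⟨w, hw, hd⟩ := Set.encard_ne_zero.mp hpos
  obtain rfl : w = p := by simpa using hw
  exact hd huv

/-- If `f` is an injective continuous real function on a path-connected space, then the points
with values between `f p` and `f y` lie on any path from `p` to `y`. -/
lemma preimage_Icc_subset_range_path {X : Type*} [TopologicalSpace X] {f : X → ℝ}
    (hf : Continuous f) (hinj : Function.Injective f) {p y : X} (γ : Path p y) :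
    f ⁻¹' Icc (f p) (f y) ⊆ range γ := by
  intro x hx
  have hmem : f x ∈ range (f ∘ γ) :=
    mem_range_of_exists_le_of_exists_ge (hf.comp γ.continuous)
      ⟨0, by simpa using hx.1⟩ ⟨1, by simpa using hx.2⟩
  obtain ⟨t, ht⟩ := hmem
  exact ⟨t, hinj ht⟩

/-- A path-connected space with an injective continuous real function that attains both its
minimum and a larger maximum is an arc. -/
lemma nonempty_homeomorph_Icc {X : Type*} [TopologicalSpace X] [PathConnectedSpace X]
    {f : X → ℝ} (hf : Continuous f) (hinj : Function.Injective f) {p y : X}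
    (hp : ∀ x, f p ≤ f x) (hy : ∀ x, f x ≤ f y) (hpy : f p < f y) :
    Nonempty (X ≃ₜ Icc (0 : ℝ) 1) := by
  obtain ⟨γ⟩ := PathConnectedSpace.joined p y
  have huniv : range γ = univ := eq_univ_of_forall fun x =>
    preimage_Icc_subset_range_path hf hinj γ ⟨hp x, hy x⟩
  have : CompactSpace X := ⟨huniv ▸ isCompact_range γ.continuous⟩
  have hrange : range f = Icc (f p) (f y) := by
    refine Subset.antisymm (range_subset_iff.mpr fun x => ⟨hp x, hy x⟩) fun r hr => ?_
    exact mem_range_of_exists_le_of_exists_ge hf ⟨p, hr.1⟩ ⟨y, hr.2⟩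
  exact ⟨((hf.isClosedEmbedding hinj).isEmbedding.toHomeomorph.trans
    (Homeomorph.setCongr hrange)).trans (iccHomeoI (f p) (f y) hpy)⟩

/-- A path-connected space with an injective continuous nonnegative real function that vanishes
somewhere and is unbounded is a closed half-line. -/
lemma nonempty_homeomorph_Ici {X : Type*} [TopologicalSpace X] [PathConnectedSpace X]
    {f : X → ℝ} (hf : Continuous f) (hinj : Function.Injective f) {p : X}
    (h0 : f p = 0) (hp : ∀ x, 0 ≤ f x) (hunb : ∀ R, ∃ y, R ≤ f y) :
    Nonempty (X ≃ₜ Ici (0 : ℝ)) := by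
  have hproper : IsProperMap f := by
    refine isProperMap_iff_isCompact_preimage.mpr ⟨hf, fun K hK => ?_⟩
    obtain ⟨R, hR⟩ := hK.bddAbove
    obtain ⟨y, hy⟩ := hunb R
    obtain ⟨γ⟩ := PathConnectedSpace.joined p y
    refine (isCompact_range γ.continuous).of_isClosed_subset (hK.isClosed.preimage hf) ?_
    exact fun x hx => preimage_Icc_subset_range_path hf hinj γ
      ⟨h0 ▸ hp x, (hR hx).trans hy⟩
  have hrange : range f = Ici 0 := by
    refine Subset.antisymm (range_subset_iff.mpr hp) fun r hr => ?_
    exact mem_range_of_exists_le_of_exists_ge hf ⟨p, h0.trans_le hr⟩ (hunb r)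
  exact ⟨(Topology.IsClosedEmbedding.of_continuous_injective_isClosedMap hf hinj
    hproper.isClosedMap).isEmbedding.toHomeomorph.trans (Homeomorph.setCongr hrange)⟩

/-- An arcwise (path-)connected metric space (with at least three points)
with `dim_1(X) = 1` is a Jordan arc: it is homeomorphic to `[0,1]` or to `[0,∞)`. -/
theorem jordan_arc_of_pathConnected_dim_one {X : Type*} [MetricSpace X]
    [PathConnectedSpace X] (hX : ∃ a b c : X, a ≠ b ∧ a ≠ c ∧ b ≠ c)
    (hdim : kMetricDim (fun x y : X => dist x y) 1 = 1) :
    Nonempty (X ≃ₜ Set.Icc (0 : ℝ) 1) ∨ Nonempty (X ≃ₜ Set.Ici (0 : ℝ)) := by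
  obtain ⟨a, b, -, hab, -, -⟩ := hX
  have : Nontrivial X := ⟨a, b, hab⟩
  obtain ⟨p, hinj⟩ := exists_dist_injective_of_kMetricDim_one hdim
  have hf : Continuous fun x => dist x p := continuous_id.dist continuous_const
  by_cases hmax : ∃ y, ∀ x, dist x p ≤ dist y p
  · obtain ⟨y, hy⟩ := hmax
    obtain ⟨z, hz⟩ := exists_ne p
    refine Or.inl (nonempty_homeomorph_Icc hf hinj (p := p) (fun x => ?_) hy ?_)
    · simp
    · simpa using (dist_pos.mpr hz).trans_le (hy z)
  push Not at hmax
  right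
  by_cases hbdd : BddAbove (range fun x => dist x p)
  swap
  · refine nonempty_homeomorph_Ici hf hinj (dist_self p) (fun x => dist_nonneg) fun R => ?_
    obtain ⟨_, ⟨y, rfl⟩, hy⟩ := not_bddAbove_iff.mp hbdd R
    exact ⟨y, hy.le⟩
  set M := sSup (range fun x => dist x p)
  have hlt (x : X) : 0 < M - dist x p := by
    obtain ⟨y, hy⟩ := hmax x
    exact sub_pos.mpr (hy.trans_le (le_csSup hbdd ⟨y, rfl⟩))
  have hM : 0 < M := by simpa using hlt p
  refine nonempty_homeomorph_Ici (f := fun x => dist x p / (M - dist x p)) (p := p)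
    (hf.div (continuous_const.sub hf) fun x => (hlt x).ne') (fun x y hxy => hinj ?_) (by simp)
    (fun x => div_nonneg dist_nonneg (hlt x).le) fun R => ?_
  · have hxy' := (div_eq_div_iff (hlt x).ne' (hlt y).ne').mp hxy
    exact mul_right_cancel₀ hM.ne' (by linear_combination hxy')
  · have hR : 0 < 1 + |R| := by positivity
    have hRM : M * |R| / (1 + |R|) < M := by
      rw [div_lt_iff₀ hR]
      linarith
    obtain ⟨_, ⟨y, rfl⟩, hy⟩ := exists_lt_of_lt_csSup (range_nonempty _) hRM
    refine ⟨y, (le_abs_self R).trans ((le_div_iff₀ (hlt y)).mpr ?_)⟩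
    have hy' := (div_lt_iff₀ hR).mp hy
    linarith
end

section
/- Let (X,d) be a metric space, k a positive integer, and 0 < s < t. Then dim^s_k(X) ≥ dim^t_k(X) ≥ dim_k(X), where dim^t_k(X) denotes the k-metric dimension of the metric space (X, d^t). -/
open Set

theorem IsKMetricGenerator.mono {X α β : Type*} {ρ : X → X → α} {σ : X → X → β} {k : ℕ}
    {S : Set X} (h : IsKMetricGenerator σ k S)
    (hρσ : ∀ u v w, ρ u w = ρ v w → σ u w = σ v w) : IsKMetricGenerator ρ k S :=
  fun u v huv => (h u v huv).trans <|
    Set.encard_le_encard fun w hw => ⟨hw.1, mt (hρσ u v w) hw.2⟩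

theorem kMetricDim_le_of_imp {X α β : Type*} {ρ : X → X → α} {σ : X → X → β} (k : ℕ)
    (hρσ : ∀ u v w, ρ u w = ρ v w → σ u w = σ v w) : kMetricDim ρ k ≤ kMetricDim σ k :=
  sInf_le_sInf fun _ ⟨S, hS, hn⟩ => ⟨S, hS.mono hρσ, hn⟩

/-- For a metric space `X` (with at least three points), `k ≥ 1` and
`0 < s < t`: `dim^s_k(X) ≥ dim^t_k(X) ≥ dim_k(X)`, where `dim^r_k` is the `k`-metric
dimension for the truncated metric `d^r(x,y) = min{d(x,y), 2r}`. -/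
theorem kMetricDim_truncated_monotone {X : Type*} [MetricSpace X]
    (hX : ∃ a b c : X, a ≠ b ∧ a ≠ c ∧ b ≠ c)
    (k : ℕ) (hk : 1 ≤ k) (s t : ℝ) (hs : 0 < s) (hst : s < t) :
    kMetricDim (fun x y : X => min (dist x y) (2 * t)) k ≤
      kMetricDim (fun x y : X => min (dist x y) (2 * s)) k ∧
    kMetricDim (fun x y : X => dist x y) k ≤
      kMetricDim (fun x y : X => min (dist x y) (2 * t)) k := by
  refine ⟨kMetricDim_le_of_imp k fun u v w h => ?_, kMetricDim_le_of_imp k fun u v w h => ?_⟩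
  · have hmin : min (2 * t) (2 * s) = 2 * s := min_eq_right (by linarith)
    simpa only [min_assoc, hmin] using congrArg (min · (2 * s)) h
  · exact congrArg (min · (2 * t)) h
end

section
/- Let (X_1,d_1) and (X_2,d_2) be metric spaces with disjoint underlying sets, let t > 0, and let k be a positive integer. Then dim_k(X_1) + dim_k(X_2) ≤ dim^t_k(X_1) + dim^t_k(X_2) ≤ dim^t_k(X_1 + X_2), where dim^t_k(X_1 + X_2) is the k-metric dimension of the join (X_1 ∪ X_2, d^t). -/
open Set

/-- The join metric on the disjoint union `X₁ ⊕ X₂`: within each part the truncated metric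
`min{dᵢ(u,v), 2t}`, and distance `t` between points of different parts. -/
def joinDist {X₁ X₂ : Type*} (d₁ : X₁ → X₁ → ℝ) (d₂ : X₂ → X₂ → ℝ) (t : ℝ) :
    X₁ ⊕ X₂ → X₁ ⊕ X₂ → ℝ
  | Sum.inl u, Sum.inl v => min (d₁ u v) (2 * t)
  | Sum.inr u, Sum.inr v => min (d₂ u v) (2 * t)
  | _, _ => t

/-- A generator for a post-composition `f ∘ ρ` is a generator for `ρ`. -/
theorem IsKMetricGenerator.of_comp {X α β : Type*} {ρ : X → X → α} (f : α → β) {k : ℕ}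
    {S : Set X} (h : IsKMetricGenerator (fun x y => f (ρ x y)) k S) :
    IsKMetricGenerator ρ k S := fun u v huv =>
  (h u v huv).trans <| encard_le_encard fun _ hw => ⟨hw.1, fun e => hw.2 (congrArg f e)⟩

theorem kMetricDim_le_card {X α : Type*} {ρ : X → X → α} {k : ℕ} {S : Finset X}
    (h : IsKMetricGenerator ρ k (S : Set X)) : kMetricDim ρ k ≤ S.card :=
  sInf_le ⟨S, h, rfl⟩

theorem kMetricDim_le_comp {X α β : Type*} (ρ : X → X → α) (f : α → β) (k : ℕ) :
    kMetricDim ρ k ≤ kMetricDim (fun x y => f (ρ x y)) k := by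
  refine le_sInf ?_
  rintro _ ⟨S, hS, rfl⟩
  exact kMetricDim_le_card (hS.of_comp f)

/-- A generator for `ρ` pulls back along an injection `i` outside whose range `ρ (i u)` does not
depend on `u`. -/
theorem IsKMetricGenerator.preimage {X Y α : Type*} {ρ : Y → Y → α} {k : ℕ} {S : Set Y}
    (h : IsKMetricGenerator ρ k S) {i : X → Y} (hi : i.Injective)
    (hρ : ∀ u v : X, ∀ w ∉ range i, ρ (i u) w = ρ (i v) w) :
    IsKMetricGenerator (fun x y => ρ (i x) (i y)) k (i ⁻¹' S) := by
  intro u v huv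
  refine (h (i u) (i v) (hi.ne huv)).trans ?_
  rw [← hi.encard_image]
  refine encard_le_encard fun w ⟨hwS, hw⟩ => ?_
  obtain ⟨x, rfl⟩ : w ∈ range i := by
    by_contra hn
    exact hw (hρ u v w hn)
  exact ⟨x, ⟨hwS, hw⟩, rfl⟩

/-- The dimensions of the truncated metrics add up to at most the dimension of the join. -/
theorem kMetricDim_add_le_joinDist {X₁ X₂ : Type*} (d₁ : X₁ → X₁ → ℝ) (d₂ : X₂ → X₂ → ℝ)
    (t : ℝ) (k : ℕ) :
    kMetricDim (fun x y => min (d₁ x y) (2 * t)) k +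
        kMetricDim (fun x y => min (d₂ x y) (2 * t)) k ≤
      kMetricDim (joinDist d₁ d₂ t) k := by
  refine le_sInf ?_
  rintro _ ⟨S, hS, rfl⟩
  have h₁ : IsKMetricGenerator (fun x y => min (d₁ x y) (2 * t)) k (S.toLeft : Set X₁) := by
    have hpre : (S.toLeft : Set X₁) = Sum.inl ⁻¹' (S : Set (X₁ ⊕ X₂)) := by ext; simp
    rw [hpre]
    refine hS.preimage Sum.inl_injective ?_
    rintro u v (w | w) hw
    · exact absurd ⟨w, rfl⟩ hw
    · rfl
  have h₂ : IsKMetricGenerator (fun x y => min (d₂ x y) (2 * t)) k (S.toRight : Set X₂) := by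
    have hpre : (S.toRight : Set X₂) = Sum.inr ⁻¹' (S : Set (X₁ ⊕ X₂)) := by ext; simp
    rw [hpre]
    refine hS.preimage Sum.inr_injective ?_
    rintro u v (w | w) hw
    · rfl
    · exact absurd ⟨w, rfl⟩ hw
  rw [← S.card_toLeft_add_card_toRight, Nat.cast_add]
  exact add_le_add (kMetricDim_le_card h₁) (kMetricDim_le_card h₂)

/-- For disjoint metric spaces `X₁, X₂`, `t > 0` and `k ≥ 1`:
`dim_k(X₁) + dim_k(X₂) ≤ dim^t_k(X₁) + dim^t_k(X₂) ≤ dim^t_k(X₁ + X₂)`. -/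
theorem kMetricDim_join_lower_bound {X₁ X₂ : Type*} [MetricSpace X₁] [MetricSpace X₂]
    (t : ℝ) (ht : 0 < t) (k : ℕ) (hk : 1 ≤ k) :
    kMetricDim (fun x y : X₁ => dist x y) k + kMetricDim (fun x y : X₂ => dist x y) k ≤
      kMetricDim (fun x y : X₁ => min (dist x y) (2 * t)) k +
        kMetricDim (fun x y : X₂ => min (dist x y) (2 * t)) k ∧
    kMetricDim (fun x y : X₁ => min (dist x y) (2 * t)) k +
        kMetricDim (fun x y : X₂ => min (dist x y) (2 * t)) k ≤
      kMetricDim (joinDist (fun x y : X₁ => dist x y) (fun x y : X₂ => dist x y) t) k :=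
  ⟨add_le_add (kMetricDim_le_comp _ (min · (2 * t)) k) (kMetricDim_le_comp _ (min · (2 * t)) k),
    kMetricDim_add_le_joinDist _ _ t k⟩
end

section
/- Let X = {√p : p a prime number} ⊆ ℝ with the Euclidean metric d(x,y) = |x−y|. Then for all distinct primes p and q the bisector B(√p|√q) is empty (equivalently, there is no prime r with 2√r = √p + √q); consequently dim_k(X) = k for every positive integer k. -/
open Set

/-- The set of square roots of prime numbers, as a subset of `ℝ`. -/
def primeSqrtSet : Set ℝ := {x : ℝ | ∃ p : ℕ, p.Prime ∧ x = Real.sqrt p}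

theorem Nat.Prime.not_isSquare_mul {p q : ℕ} (hp : p.Prime) (hq : q.Prime) (hpq : p ≠ q) :
    ¬ IsSquare (p * q) := by
  rintro ⟨n, hn⟩
  have hpn : p ∣ n := by
    have h : p ∣ n * n := hn ▸ dvd_mul_right p q
    exact (hp.dvd_mul.mp h).elim id id
  have h : p * p ∣ p * q := hn ▸ mul_dvd_mul hpn hpn
  exact hpq ((Nat.prime_dvd_prime_iff_eq hp hq).mp (Nat.dvd_of_mul_dvd_mul_left hp.pos h))

theorem two_mul_sqrt_ne_sqrt_add_sqrt {p q : ℕ} (r : ℕ) (hp : p.Prime) (hq : q.Prime)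
    (hpq : p ≠ q) : 2 * √(r : ℝ) ≠ √(p : ℝ) + √(q : ℝ) := by
  intro h
  have hirr : Irrational (√((p * q : ℕ) : ℝ)) :=
    irrational_sqrt_natCast_iff.mpr (hp.not_isSquare_mul hq hpq)
  refine hirr ⟨(4 * r - p - q) / 2, ?_⟩
  have hr : √(r : ℝ) ^ 2 = r := Real.sq_sqrt r.cast_nonneg
  have hp' : √(p : ℝ) ^ 2 = p := Real.sq_sqrt p.cast_nonneg
  have hq' : √(q : ℝ) ^ 2 = q := Real.sq_sqrt q.cast_nonneg
  have hsq := congrArg (· ^ 2) h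
  push_cast
  rw [Real.sqrt_mul p.cast_nonneg]
  linear_combination hsq / 2 - 2 * hr + hp' / 2 + hq' / 2

theorem dist_sqrt_ne_dist_sqrt {p q : ℕ} (hp : p.Prime) (hq : q.Prime) (hpq : p ≠ q)
    {x : ℝ} (hx : x ∈ primeSqrtSet) : dist x (√(p : ℝ)) ≠ dist x (√(q : ℝ)) := by
  obtain ⟨r, -, rfl⟩ := hx
  rw [Real.dist_eq, Real.dist_eq]
  intro h
  rcases abs_eq_abs.mp h with h | h
  · have h' : √(p : ℝ) = √(q : ℝ) := by linarith
    rw [Real.sqrt_inj p.cast_nonneg q.cast_nonneg] at h'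
    exact hpq (mod_cast h')
  · exact two_mul_sqrt_ne_sqrt_add_sqrt r hp hq hpq (by linarith)

theorem infinite_primeSqrtSet : primeSqrtSet.Infinite := by
  have himage : (fun n : ℕ => √(n : ℝ)) '' {p | p.Prime} ⊆ primeSqrtSet := by
    rintro _ ⟨p, hp, rfl⟩
    exact ⟨p, hp, rfl⟩
  refine (Nat.infinite_setOfPred_prime.image ?_).mono himage
  intro a _ b _ h
  exact_mod_cast (Real.sqrt_inj a.cast_nonneg b.cast_nonneg).mp h

/-- In an infinite space all of whose bisectors are empty, the `k`-metric dimension is `k`. -/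
theorem kMetricDim_eq_of_forall_ne {X α : Type*} [Infinite X] {ρ : X → X → α}
    (hρ : ∀ u v : X, u ≠ v → ∀ w, ρ u w ≠ ρ v w) (k : ℕ) : kMetricDim ρ k = k := by
  apply le_antisymm
  · obtain ⟨S, hS⟩ := Infinite.exists_subset_card_eq X k
    refine sInf_le ⟨S, fun u v huv => ?_, by rw [hS]⟩
    have hsep : {w ∈ (S : Set X) | ρ u w ≠ ρ v w} = S :=
      Set.sep_eq_self_iff_mem_true.mpr fun w _ => hρ u v huv w
    rw [hsep, Set.encard_coe_eq_coe_finsetCard, hS]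
  · refine le_sInf ?_
    rintro _ ⟨S, hS, rfl⟩
    obtain ⟨u, v, huv⟩ := exists_pair_ne X
    rw [← Set.encard_coe_eq_coe_finsetCard]
    exact (hS u v huv).trans (Set.encard_le_encard (Set.sep_subset _ _))

/-- In `X = {√p : p prime} ⊆ ℝ` with the Euclidean metric, the bisector
`B(√p|√q)` is empty for all distinct primes `p, q`; consequently `dim_k(X) = k` for every
positive integer `k`. -/
theorem primeSqrt_dim_eq :
    (∀ p q : ℕ, p.Prime → q.Prime → p ≠ q →
      ∀ x ∈ primeSqrtSet, dist x (Real.sqrt p) ≠ dist x (Real.sqrt q)) ∧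
    (∀ k : ℕ, 1 ≤ k →
      kMetricDim (fun a b : primeSqrtSet => dist a b) k = (k : ℕ∞)) := by
  refine ⟨fun p q hp hq hpq x hx => dist_sqrt_ne_dist_sqrt hp hq hpq hx, fun k _ => ?_⟩
  have : Infinite primeSqrtSet := infinite_primeSqrtSet.to_subtype
  refine kMetricDim_eq_of_forall_ne ?_ k
  rintro ⟨_, p, hp, rfl⟩ ⟨_, q, hq, rfl⟩ huv w
  have hpq : p ≠ q := by
    rintro rfl
    exact huv rfl
  rw [dist_comm _ w, dist_comm _ w]
  exact dist_sqrt_ne_dist_sqrt hp hq hpq w.2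
end

section
/- Let X be the real interval [0,1] with the Euclidean metric d(x,y) = |x−y|. Then dim_1(X) = 1, dim_2(X) = 2, and dim_k(X) = k + 1 for every k ≥ 3 (for k ≥ 3 the set {0, 1/k, 2/k, ..., (k−1)/k, 1} is a k-metric generator of minimum cardinality). -/
open Set

/-- A generator has at least `k` points, as soon as the space has two points. -/
lemma IsKMetricGenerator.le_encard {X α : Type*} [Nontrivial X] {ρ : X → X → α} {k : ℕ}
    {S : Set X} (h : IsKMetricGenerator ρ k S) : (k : ℕ∞) ≤ S.encard := by
  obtain ⟨u, v, huv⟩ := exists_pair_ne X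
  exact (h u v huv).trans (encard_le_encard (sep_subset _ _))

lemma kMetricDim_le {X α : Type*} {ρ : X → X → α} {k : ℕ} {S : Set X} {n : ℕ}
    (hS : S.encard = n) (h : IsKMetricGenerator ρ k S) : kMetricDim ρ k ≤ n := by
  have hfin : S.Finite := finite_of_encard_eq_coe hS
  refine sInf_le ⟨hfin.toFinset, by simpa using h, ?_⟩
  rw [← hS, hfin.encard_eq_coe_toFinset_card]

lemma le_kMetricDim {X α : Type*} {ρ : X → X → α} {k : ℕ} {n : ℕ∞}
    (h : ∀ S : Set X, IsKMetricGenerator ρ k S → n ≤ S.encard) : n ≤ kMetricDim ρ k := by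
  refine le_sInf ?_
  rintro _ ⟨S, hS, rfl⟩
  simpa using h S hS

lemma unitInterval_dist_eq_iff {u v w : Icc (0 : ℝ) 1} (huv : u ≠ v) :
    dist u w = dist v w ↔ (u : ℝ) + v = 2 * w := by
  have huv' : (u : ℝ) ≠ v := fun h => huv (Subtype.ext h)
  rw [Subtype.dist_eq, Subtype.dist_eq, Real.dist_eq, Real.dist_eq, abs_eq_abs]
  constructor
  · rintro (h | h)
    · exact absurd (by linarith) huv'
    · linarith
  · intro h
    right
    linarith

/-- A set with more than `k` points is a `k`-metric generator, since bisectors are points. -/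
lemma unitInterval_isKMetricGenerator_of_lt {k : ℕ} {S : Set (Icc (0 : ℝ) 1)}
    (hS : (k : ℕ∞) + 1 ≤ S.encard) :
    IsKMetricGenerator (fun a b : Icc (0 : ℝ) 1 => dist a b) k S := by
  intro u v huv
  let m : Icc (0 : ℝ) 1 := ⟨((u : ℝ) + v) / 2, by
    have := u.2.1; have := v.2.1; have := u.2.2; have := v.2.2
    constructor <;> linarith⟩
  have hsub : S \ {m} ⊆ {w ∈ S | dist u w ≠ dist v w} := by
    rintro w ⟨hw, hwm⟩
    refine ⟨hw, fun h => hwm (Subtype.ext ?_)⟩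
    have := (unitInterval_dist_eq_iff huv).1 h
    change (w : ℝ) = ((u : ℝ) + v) / 2
    linarith
  have h1 : (k : ℕ∞) + 1 ≤ (S \ {m}).encard + 1 :=
    hS.trans (by simpa using encard_le_encard_sdiff_add_encard S {m})
  exact (WithTop.add_le_add_iff_right ENat.one_ne_top |>.1 h1).trans (encard_le_encard hsub)

/-- The endpoints of the unit interval lie on no bisector. -/
lemma unitInterval_isKMetricGenerator_of_subset_endpoints {k : ℕ} {S : Set (Icc (0 : ℝ) 1)}
    (hS : S.encard = k) (hsub : S ⊆ {0, 1}) :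
    IsKMetricGenerator (fun a b : Icc (0 : ℝ) 1 => dist a b) k S := by
  intro u v huv
  rw [← hS]
  refine encard_le_encard fun w hw => ⟨hw, fun h => huv (Subtype.ext ?_)⟩
  have h' := (unitInterval_dist_eq_iff huv).1 h
  have := u.2.1; have := v.2.1; have := u.2.2; have := v.2.2
  rcases hsub hw with rfl | rfl
  · rw [Icc.coe_zero] at h'
    linarith
  · rw [Icc.coe_one] at h'
    linarith

/-- Every interior point of the unit interval is the bisector of some pair of points. -/
lemma unitInterval_exists_dist_eq {w : Icc (0 : ℝ) 1} (h0 : w ≠ 0) (h1 : w ≠ 1) :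
    ∃ u v : Icc (0 : ℝ) 1, u ≠ v ∧ dist u w = dist v w := by
  have hw0 : (0 : ℝ) < w := lt_of_le_of_ne w.2.1 fun h => h0 (Subtype.ext h.symm)
  have hw1 : (w : ℝ) < 1 := lt_of_le_of_ne w.2.2 fun h => h1 (Subtype.ext h)
  obtain ⟨e, he, hew⟩ := exists_between (lt_min hw0 (sub_pos.2 hw1))
  obtain ⟨he0, he1⟩ := lt_min_iff.1 hew
  have hne : (⟨w - e, by constructor <;> linarith⟩ : Icc (0 : ℝ) 1) ≠
      ⟨w + e, by constructor <;> linarith⟩ := by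
    intro h
    have := congrArg Subtype.val h
    dsimp only at this
    linarith
  exact ⟨_, _, hne, (unitInterval_dist_eq_iff hne).2 (by ring)⟩

lemma unitInterval_succ_le_encard {k : ℕ} (hk : 3 ≤ k) {S : Set (Icc (0 : ℝ) 1)}
    (hS : IsKMetricGenerator (fun a b : Icc (0 : ℝ) 1 => dist a b) k S) :
    (k : ℕ∞) + 1 ≤ S.encard := by
  have hk' : ((3 : ℕ) : ℕ∞) ≤ S.encard := (Nat.cast_le.2 hk).trans hS.le_encard
  obtain ⟨w, hwS, hw⟩ : ∃ w ∈ S, w ∉ ({0, 1} : Set (Icc (0 : ℝ) 1)) := by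
    by_contra! h
    have h3 := hk'.trans ((encard_le_encard h).trans (encard_pair zero_ne_one).le)
    exact absurd (Nat.cast_le (α := ℕ∞) (m := 3) (n := 2) |>.1 h3) (by norm_num)
  rw [mem_insert_iff, mem_singleton_iff, not_or] at hw
  obtain ⟨u, v, huv, h⟩ := unitInterval_exists_dist_eq hw.1 hw.2
  have hsub : {x ∈ S | dist u x ≠ dist v x} ⊆ S \ {w} := by
    rintro x ⟨hx, hne⟩
    exact ⟨hx, fun hxw => hne (by rw [mem_singleton_iff.1 hxw, h])⟩
  rw [← encard_sdiff_singleton_add_one hwS]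
  gcongr
  exact (hS u v huv).trans (encard_le_encard hsub)

lemma unitInterval_encard_equally_spaced {k : ℕ} (hk : 0 < k) :
    {x : Icc (0 : ℝ) 1 | ∃ i : ℕ, i ≤ k ∧ (x : ℝ) = (i : ℝ) / k}.encard = (k : ℕ∞) + 1 := by
  have hk' : (0 : ℝ) < k := Nat.cast_pos.2 hk
  rw [← Subtype.val_injective.encard_image]
  have himage : Subtype.val '' {x : Icc (0 : ℝ) 1 | ∃ i : ℕ, i ≤ k ∧ (x : ℝ) = (i : ℝ) / k} =
      (fun i : ℕ => (i : ℝ) / k) '' (Finset.range (k + 1) : Set ℕ) := by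
    ext y
    constructor
    · rintro ⟨x, ⟨i, hi, hx⟩, rfl⟩
      exact ⟨i, by simpa [Nat.lt_succ_iff] using hi, hx.symm⟩
    · rintro ⟨i, hi, rfl⟩
      have hi' : i ≤ k := by simpa [Nat.lt_succ_iff] using hi
      exact ⟨⟨(i : ℝ) / k, by positivity, (div_le_one hk').2 (Nat.cast_le.2 hi')⟩,
        ⟨i, hi', rfl⟩, rfl⟩
  have hinj : Function.Injective fun i : ℕ => (i : ℝ) / k := fun i j hij =>
    Nat.cast_injective ((div_left_inj' hk'.ne').1 hij)
  rw [himage, hinj.encard_image, encard_coe_eq_coe_finsetCard, Finset.card_range]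
  push_cast
  rfl

/-- For `X = [0,1]` with the Euclidean metric: `dim_1(X) = 1`,
`dim_2(X) = 2`, and for every `k ≥ 3` one has `dim_k(X) = k + 1`, the set
`{0, 1/k, 2/k, …, (k−1)/k, 1}` being a `k`-metric generator of minimum cardinality. -/
theorem unit_interval_dim_seq :
    kMetricDim (fun a b : Set.Icc (0 : ℝ) 1 => dist a b) 1 = 1 ∧
    kMetricDim (fun a b : Set.Icc (0 : ℝ) 1 => dist a b) 2 = 2 ∧
    ∀ k : ℕ, 3 ≤ k →
      kMetricDim (fun a b : Set.Icc (0 : ℝ) 1 => dist a b) k = (k : ℕ∞) + 1 ∧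
      IsKMetricGenerator (fun a b : Set.Icc (0 : ℝ) 1 => dist a b) k
        {x : Set.Icc (0 : ℝ) 1 | ∃ i : ℕ, i ≤ k ∧ (x : ℝ) = (i : ℝ) / k} ∧
      {x : Set.Icc (0 : ℝ) 1 | ∃ i : ℕ, i ≤ k ∧ (x : ℝ) = (i : ℝ) / k}.encard
        = (k : ℕ∞) + 1 := by
  have endpoints {k : ℕ} {S : Set (Icc (0 : ℝ) 1)} (hS : S.encard = k) (hsub : S ⊆ {0, 1}) :
      kMetricDim (fun a b : Icc (0 : ℝ) 1 => dist a b) k = k :=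
    le_antisymm (kMetricDim_le hS (unitInterval_isKMetricGenerator_of_subset_endpoints hS hsub))
      (le_kMetricDim fun _ hT => hT.le_encard)
  refine ⟨endpoints (k := 1) (S := {0}) (by simp) (by simp),
    endpoints (k := 2) (S := {0, 1}) (encard_pair zero_ne_one) subset_rfl, fun k hk => ?_⟩
  have hcard := unitInterval_encard_equally_spaced (k := k) (by omega)
  have hgen := unitInterval_isKMetricGenerator_of_lt hcard.ge
  exact ⟨le_antisymm (kMetricDim_le (n := k + 1) (by exact_mod_cast hcard) hgen)
    (le_kMetricDim fun S hS => unitInterval_succ_le_encard hk hS), hgen, hcard⟩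
end

section
/- Let X = ℝ with the Euclidean metric d(x,y) = |x−y|. Then dim_k(X) = k + 1 for every positive integer k; that is, ℝ has dimension sequence (2, 3, 4, ...). -/
open Set

/-- A real point equidistant from two distinct points is their midpoint. -/
theorem Real.eq_midpoint_of_dist_eq {u v w : ℝ} (huv : u ≠ v) (h : dist u w = dist v w) :
    w = (u + v) / 2 := by
  rw [Real.dist_eq, Real.dist_eq, abs_eq_abs] at h
  rcases h with h | h
  · exact absurd (by linarith) huv
  · linarith

/-- Every finite set of `k + 1` real numbers is a `k`-metric generator of `ℝ`. -/
theorem Real.isKMetricGenerator_of_card {k : ℕ} {S : Finset ℝ} (hS : S.card = k + 1) :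
    IsKMetricGenerator (fun x y : ℝ => dist x y) k (S : Set ℝ) := by
  intro u v huv
  have hsub : ((S.erase ((u + v) / 2) : Finset ℝ) : Set ℝ) ⊆
      {w ∈ (S : Set ℝ) | dist u w ≠ dist v w} := by
    intro w hw
    have hw' := Finset.mem_erase.1 (Finset.mem_coe.1 hw)
    exact ⟨hw'.2, fun h => hw'.1 (Real.eq_midpoint_of_dist_eq huv h)⟩
  refine le_trans ?_ (Set.encard_le_encard hsub)
  rw [Set.encard_coe_eq_coe_finsetCard, Nat.cast_le]
  have := Finset.pred_card_le_card_erase (s := S) (a := (u + v) / 2)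
  omega

/-- For `1 ≤ k`, a finite `k`-metric generator of `ℝ` has at least `k + 1` points. -/
theorem Real.succ_le_card_of_isKMetricGenerator {k : ℕ} (hk : 1 ≤ k) {S : Finset ℝ}
    (hS : IsKMetricGenerator (fun x y : ℝ => dist x y) k (S : Set ℝ)) : k + 1 ≤ S.card := by
  obtain ⟨w, hw⟩ : S.Nonempty := by
    rw [← Finset.card_pos]
    have h := (hS 0 1 zero_ne_one).trans (Set.encard_le_encard (Set.sep_subset _ _))
    rw [Set.encard_coe_eq_coe_finsetCard, Nat.cast_le] at h
    omega
  have hsub : {x ∈ (S : Set ℝ) | dist (w - 1) x ≠ dist (w + 1) x} ⊆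
      ((S.erase w : Finset ℝ) : Set ℝ) := by
    rintro x ⟨hx, hne⟩
    refine Finset.mem_coe.2 (Finset.mem_erase.2 ⟨?_, hx⟩)
    rintro rfl
    exact hne (by simp)
  have h := (hS (w - 1) (w + 1) (by linarith : w - 1 < w + 1).ne).trans
    (Set.encard_le_encard hsub)
  rw [Set.encard_coe_eq_coe_finsetCard, Nat.cast_le, Finset.card_erase_of_mem hw] at h
  omega

/-- For `X = ℝ` with the Euclidean metric, `dim_k(ℝ) = k + 1` for every
positive integer `k`; i.e. `ℝ` has dimension sequence `(2, 3, 4, …)`. -/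
theorem real_dim_seq (k : ℕ) (hk : 1 ≤ k) :
    kMetricDim (fun x y : ℝ => dist x y) k = (k : ℕ∞) + 1 := by
  apply le_antisymm
  · obtain ⟨S, hS⟩ := Infinite.exists_subset_card_eq ℝ (k + 1)
    exact sInf_le ⟨S, Real.isKMetricGenerator_of_card hS, by simp [hS]⟩
  · refine le_sInf ?_
    rintro _ ⟨S, hS, rfl⟩
    exact_mod_cast Real.succ_le_card_of_isKMetricGenerator hk hS
end

section
/- Let n be a positive integer and let X = ℝ^n with the Euclidean metric. Then dim_k(X) = n + k for every positive integer k; in particular Euclidean n-space has dimension sequence (n+1, n+2, n+3, ...). -/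
open Set

open scoped Classical in
theorem isKMetricGenerator_coe_iff {X α : Type*} (ρ : X → X → α) (k : ℕ) (S : Finset X) :
    IsKMetricGenerator ρ k (S : Set X) ↔
      ∀ u v : X, u ≠ v → k ≤ (S.filter fun w => ρ u w ≠ ρ v w).card := by
  refine forall_congr' fun u => forall_congr' fun v => imp_congr_right fun _ => ?_
  have h : {w ∈ (S : Set X) | ρ u w ≠ ρ v w}
      = ((S.filter fun w => ρ u w ≠ ρ v w : Finset X) : Set X) := by
    ext; simp
  rw [h, Set.encard_coe_eq_coe_finsetCard, Nat.cast_le]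

/-- Fewer points than the dimension always have a common nonzero orthogonal vector. -/
theorem exists_ne_zero_forall_inner_eq_zero {n : ℕ} (T : Finset (EuclideanSpace ℝ (Fin n)))
    (hT : T.card < n) :
    ∃ x : EuclideanSpace ℝ (Fin n), x ≠ 0 ∧ ∀ t ∈ T, inner ℝ t x = 0 := by
  let f : EuclideanSpace ℝ (Fin n) →ₗ[ℝ] (T → ℝ) :=
    LinearMap.pi fun t => (innerSL ℝ (t : EuclideanSpace ℝ (Fin n))).toLinearMap
  have hf : LinearMap.ker f ≠ ⊥ := LinearMap.ker_ne_bot_of_finrank_lt (by simpa using hT)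
  obtain ⟨x, hx, hx0⟩ := Submodule.exists_mem_ne_zero_of_ne_bot hf
  exact ⟨x, hx0, fun t ht => congrFun (LinearMap.mem_ker.mp hx) ⟨t, ht⟩⟩

/-- At most `n` points of `ℝⁿ` lie on a common bisector. -/
theorem exists_ne_forall_dist_eq {n : ℕ} (hn : 1 ≤ n) (T : Finset (EuclideanSpace ℝ (Fin n)))
    (hT : T.card ≤ n) :
    ∃ u v : EuclideanSpace ℝ (Fin n), u ≠ v ∧ ∀ t ∈ T, dist u t = dist v t := by
  classical
  obtain ⟨a, T', hsub, hcard⟩ : ∃ (a : EuclideanSpace ℝ (Fin n))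
      (T' : Finset (EuclideanSpace ℝ (Fin n))), T ⊆ insert a T' ∧ T'.card < n := by
    rcases T.eq_empty_or_nonempty with rfl | ⟨a, ha⟩
    · exact ⟨0, ∅, by simp, hn⟩
    · exact ⟨a, T.erase a, (Finset.insert_erase ha).ge, (Finset.card_erase_lt_of_mem ha).trans_le hT⟩
  obtain ⟨x, hx0, hx⟩ := exists_ne_zero_forall_inner_eq_zero (T'.image (· - a))
    (Finset.card_image_le.trans_lt hcard)
  refine ⟨a - x, a + x, fun h => hx0 ?_, fun t ht => ?_⟩
  · have h' : -x = x := add_left_cancel ((sub_eq_add_neg a x).symm.trans h)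
    ext i
    have hi := congrArg (fun y : EuclideanSpace ℝ (Fin n) => y i) h'
    simp only [PiLp.neg_apply] at hi
    simp only [PiLp.zero_apply]
    linarith
  · have hin : inner ℝ (t - a) x = 0 := by
      rcases Finset.mem_insert.mp (hsub ht) with rfl | h
      · simp
      · exact hx _ (Finset.mem_image_of_mem _ h)
    rw [dist_comm (a - x), dist_comm (a + x), dist_eq_norm, dist_eq_norm,
      show t - (a - x) = (t - a) + x by abel, show t - (a + x) = (t - a) - x by abel]
    exact (norm_sub_eq_norm_add (𝕜 := ℝ) (inner_eq_zero_symm.mp hin)).symm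

/-- The point with parameter `s` on the moment curve `s ↦ (s, s², …, sⁿ)`. -/
noncomputable def momentCurve (n : ℕ) (s : ℝ) : EuclideanSpace ℝ (Fin n) :=
  WithLp.toLp 2 fun j => s ^ (j.val + 1)

theorem momentCurve_injective {n : ℕ} (hn : 1 ≤ n) : Function.Injective (momentCurve n) := by
  intro s t h
  simpa [momentCurve] using congrArg (fun x : EuclideanSpace ℝ (Fin n) => x ⟨0, hn⟩) h

open Polynomial in
/-- A bisector meets the moment curve in at most `n` points. -/
theorem card_le_of_forall_dist_momentCurve_eq {n : ℕ} {u v : EuclideanSpace ℝ (Fin n)}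
    (huv : u ≠ v) (A : Finset ℝ)
    (hA : ∀ s ∈ A, dist u (momentCurve n s) = dist v (momentCurve n s)) : A.card ≤ n := by
  let q : ℝ[X] := ∑ j : Fin n, C (2 * (v j - u j)) * X ^ (j.val + 1)
    + C (∑ j, (u j ^ 2 - v j ^ 2))
  have hq0 : q ≠ 0 := by
    intro h
    apply huv
    ext i
    have hc := congrArg (fun p : ℝ[X] => p.coeff (i.val + 1)) h
    simp only [q, coeff_add, finsetSum_coeff, coeff_C_mul, coeff_X_pow, coeff_C_succ,
      Nat.add_right_cancel_iff, Fin.val_inj, coeff_zero, mul_ite, mul_one, mul_zero,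
      Finset.sum_ite_eq, Finset.mem_univ, if_true, add_zero] at hc
    linarith
  have hdeg : q.natDegree ≤ n := by
    refine natDegree_add_le_of_degree_le (natDegree_sum_le_of_forall_le _ _ fun j _ => ?_)
      ((natDegree_C _).trans_le n.zero_le)
    exact (natDegree_C_mul_X_pow_le _ _).trans j.isLt
  refine (card_le_degree_of_subset_roots (p := q) fun s hs => ?_).trans hdeg
  rw [mem_roots hq0, IsRoot.def]
  have h := hA s hs
  rw [EuclideanSpace.dist_eq, EuclideanSpace.dist_eq,
    Real.sqrt_inj (by positivity) (by positivity), ← sub_eq_zero, ← Finset.sum_sub_distrib] at h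
  simp only [Real.dist_eq, sq_abs, momentCurve] at h
  simp only [q, eval_add, eval_finsetSum, eval_mul, eval_C, eval_pow, eval_X]
  rw [← h, ← Finset.sum_add_distrib]
  exact Finset.sum_congr rfl fun j _ => by ring

/-- For Euclidean `n`-space (`n ≥ 1`), `dim_k(ℝⁿ) = n + k` for every
positive integer `k`; i.e. `ℝⁿ` has dimension sequence `(n+1, n+2, n+3, …)`. -/
theorem euclidean_dim_seq (n : ℕ) (hn : 1 ≤ n) (k : ℕ) (hk : 1 ≤ k) :
    kMetricDim (fun x y : EuclideanSpace ℝ (Fin n) => dist x y) k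
      = (n : ℕ∞) + (k : ℕ∞) := by
  classical
  apply le_antisymm
  · let S : Finset (EuclideanSpace ℝ (Fin n)) :=
      ((Finset.range (n + k)).image (Nat.cast : ℕ → ℝ)).image (momentCurve n)
    have hS : S.card = n + k := by
      rw [Finset.card_image_of_injective _ (momentCurve_injective hn),
        Finset.card_image_of_injective _ Nat.cast_injective, Finset.card_range]
    refine sInf_le ⟨S, (isKMetricGenerator_coe_iff _ _ _).mpr fun u v huv => ?_, by simp [hS]⟩
    have hle : (S.filter fun w => dist u w = dist v w).card ≤ n := by
      rw [Finset.filter_image, Finset.card_image_of_injective _ (momentCurve_injective hn)]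
      exact card_le_of_forall_dist_momentCurve_eq huv _ fun s hs => (Finset.mem_filter.mp hs).2
    have hsum := Finset.card_filter_add_card_filter_not (s := S) fun w => dist u w = dist v w
    simp only [ne_eq]
    omega
  · refine le_sInf ?_
    rintro _ ⟨S, hS, rfl⟩
    rw [isKMetricGenerator_coe_iff] at hS
    norm_cast
    by_contra! hlt
    obtain ⟨T, hTS, hT⟩ := Finset.exists_subset_card_eq (min_le_right n S.card)
    obtain ⟨u, v, huv, h⟩ := exists_ne_forall_dist_eq hn T (hT.trans_le (min_le_left _ _))
    have hsub : (S.filter fun w => dist u w ≠ dist v w) ⊆ S \ T := fun w hw => by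
      rw [Finset.mem_filter] at hw
      exact Finset.mem_sdiff.mpr ⟨hw.1, fun hwT => hw.2 (h w hwT)⟩
    have hcard := (hS u v huv).trans (Finset.card_le_card hsub)
    rw [Finset.card_sdiff_of_subset hTS] at hcard
    omega
end

section
/- Let G be a simple graph on an infinite vertex set that is a tree (connected and acyclic) in which every vertex has degree at least three, and let d be its graph metric. Then every finite set of vertices of G is contained in some bisector B(a|b) (for some distinct vertices a, b); consequently dim_k(G) = +∞ for every positive integer k. -/
open Set

namespace SimpleGraph

variable {V : Type*} {G : SimpleGraph V}

/-- A geodesic from `u` to `v` avoids every vertex that is farther from `u` than `v` is. -/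
lemma Connected.exists_walk_notMem_support (hconn : G.Connected) {u v a : V}
    (h : G.dist u v < G.dist u a) : ∃ p : G.Walk u v, a ∉ p.support := by
  classical
  obtain ⟨p, hp⟩ := hconn.exists_walk_length_eq_dist u v
  refine ⟨p, fun ha => ?_⟩
  have h₁ := dist_le (p.takeUntil a ha)
  have h₂ := p.length_takeUntil_le_length ha
  omega

/-- If an edge `v — a` of a tree points away from `r` and towards `x`, then `x` is farther
from `r` than `v` is. -/
lemma IsTree.dist_lt_dist_of_adj (hG : G.IsTree) {r x v a : V} (hadj : G.Adj v a)
    (hr : G.dist r v < G.dist r a) (hx : G.dist x a < G.dist x v) :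
    G.dist r v < G.dist r x := by
  by_contra! hle
  obtain ⟨p, hp⟩ := hG.connected.exists_walk_notMem_support hr
  obtain ⟨q, hq⟩ := hG.connected.exists_walk_notMem_support (hle.trans_lt hr)
  obtain ⟨s, hs⟩ := hG.connected.exists_walk_notMem_support hx
  have hbridge := isBridge_iff_forall_walk_mem_edges.mp
    (isAcyclic_iff_forall_adj_isBridge.mp hG.isAcyclic hadj) ((p.reverse.append q).append s)
  simp only [Walk.edges_append, Walk.edges_reverse, List.mem_append, List.mem_reverse] at hbridge
  rcases hbridge with (h | h) | h
  · exact hp (p.snd_mem_support_of_mem_edges h)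
  · exact hq (q.snd_mem_support_of_mem_edges h)
  · exact hs (s.fst_mem_support_of_mem_edges h)

/-- In a tree, a vertex has at most one neighbor closer to a given vertex. -/
lemma IsTree.eq_of_adj_of_dist_lt (hG : G.IsTree) {r v a b : V} (ha : G.Adj v a)
    (hb : G.Adj v b) (hra : G.dist r a < G.dist r v) (hrb : G.dist r b < G.dist r v) :
    a = b := by
  by_contra hab
  obtain ⟨p, hp⟩ := hG.connected.exists_walk_notMem_support hra
  obtain ⟨q, hq⟩ := hG.connected.exists_walk_notMem_support hrb
  have hbridge := isBridge_iff_forall_walk_mem_edges.mp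
    (isAcyclic_iff_forall_adj_isBridge.mp hG.isAcyclic ha)
    (Walk.cons hb (q.reverse.append p))
  simp only [Walk.edges_cons, Walk.edges_append, Walk.edges_reverse, List.mem_cons,
    List.mem_append, List.mem_reverse] at hbridge
  rcases hbridge with h | h | h
  · exact hab (Sym2.congr_right.mp h)
  · exact hq (q.fst_mem_support_of_mem_edges h)
  · exact hp (p.fst_mem_support_of_mem_edges h)

/-- In a tree, a vertex of degree at least three has two distinct neighbors farther from a given
vertex. -/
lemma IsTree.exists_ne_adj_dist_lt (hG : G.IsTree) (r : V) {v : V}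
    (hdeg : 3 ≤ (G.neighborSet v).encard) :
    ∃ a b : V, a ≠ b ∧ (G.Adj v a ∧ G.dist r v < G.dist r a) ∧
      (G.Adj v b ∧ G.dist r v < G.dist r b) := by
  set C : Set V := {n | G.Adj v n ∧ G.dist r n < G.dist r v}
  have hC : C.encard ≤ 1 := Set.encard_le_one_iff.mpr fun a b ha hb =>
    hG.eq_of_adj_of_dist_lt ha.1 hb.1 ha.2 hb.2
  have hlt : 1 < (G.neighborSet v \ C).encard := by
    by_contra! hle
    have h := (hdeg.trans (Set.encard_le_encard_sdiff_add_encard _ C)).trans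
      (add_le_add hle hC)
    norm_num at h
  have hfar : ∀ n ∈ G.neighborSet v \ C, G.Adj v n ∧ G.dist r v < G.dist r n := by
    rintro n ⟨hn, hnC⟩
    refine ⟨hn, (hG.dist_ne_of_adj r hn).lt_of_le ?_⟩
    exact not_lt.mp fun h => hnC ⟨hn, h⟩
  obtain ⟨a, b, ha, hb, hab⟩ := Set.one_lt_encard_iff.mp hlt
  exact ⟨a, b, hab, hfar a ha, hfar b hb⟩

/-- In a tree whose vertices have degree at least three, every finite set of vertices lies in
a bisector. -/
lemma IsTree.exists_subset_bisector (hG : G.IsTree)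
    (hdeg : ∀ v : V, 3 ≤ (G.neighborSet v).encard) {A : Set V} (hA : A.Finite) :
    ∃ a b : V, a ≠ b ∧ A ⊆ {x : V | G.dist x a = G.dist x b} := by
  obtain ⟨r⟩ := hG.connected.nonempty
  obtain ⟨v, -, hv⟩ := Set.exists_max_image (insert r A) (G.dist r) (hA.insert r)
    (Set.insert_nonempty r A)
  obtain ⟨a, b, hab, ⟨hva, hra⟩, hvb, hrb⟩ := hG.exists_ne_adj_dist_lt r (hdeg v)
  have key : ∀ x ∈ A, ∀ n, G.Adj v n → G.dist r v < G.dist r n →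
      G.dist x n = G.dist x v + 1 := by
    intro x hx n hn hrn
    refine (hG.dist_eq_dist_add_one_of_adj x hn).resolve_left fun h => ?_
    exact (hv x (Set.mem_insert_of_mem r hx)).not_gt
      (hG.dist_lt_dist_of_adj hn hrn (by omega))
  exact ⟨a, b, hab, fun x hx => (key x hx a hva hra).trans (key x hx b hvb hrb).symm⟩

end SimpleGraph

/-- Let `G` be a tree (connected and acyclic simple graph) on an infinite
vertex set in which every vertex has degree at least three, with graph metric `G.dist`.
Then every finite set of vertices lies in some bisector `B(a|b)`; consequently
`dim_k(G) = ∞` for every positive integer `k`. -/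
theorem infinite_tree_dim_top {V : Type*} [Infinite V] (G : SimpleGraph V)
    (hconn : G.Connected) (hacyc : G.IsAcyclic)
    (hdeg : ∀ v : V, 3 ≤ (G.neighborSet v).encard) :
    (∀ A : Set V, A.Finite →
      ∃ a b : V, a ≠ b ∧ A ⊆ {x : V | G.dist x a = G.dist x b}) ∧
    ∀ k : ℕ, 1 ≤ k → kMetricDim (fun u v : V => G.dist u v) k = ⊤ := by
  have hbis := fun (A : Set V) (hA : A.Finite) =>
    SimpleGraph.IsTree.exists_subset_bisector ⟨hconn, hacyc⟩ hdeg hA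
  refine ⟨hbis, fun k hk => sInf_eq_top.mpr ?_⟩
  rintro n ⟨S, hS, -⟩
  obtain ⟨a, b, hab, hsub⟩ := hbis S S.finite_toSet
  have hempty : {w ∈ (S : Set V) | G.dist a w ≠ G.dist b w} = ∅ := by
    refine Set.eq_empty_of_forall_notMem fun w hw => hw.2 ?_
    rw [SimpleGraph.dist_comm (u := a), SimpleGraph.dist_comm (u := b)]
    exact hsub hw.1
  have h := hS a b hab
  rw [hempty, Set.encard_empty] at h
  exact absurd (Nat.cast_eq_zero.mp (le_zero_iff.mp h)) (by omega)
end

section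
/- Let X = ℤ × ℤ with the metric d((a,b),(c,e)) = |a−c| + |b−e| (the graph metric of the Cayley graph of ℤ² with the standard generators). Then every finite subset of X is contained in some bisector B(u|v) (for some distinct u, v ∈ X); consequently dim_k(X) = +∞ for every positive integer k. -/
open Set

/-- Every finite subset of `ℤ²` lies in the bisector of two distinct adjacent points on an
antidiagonal, for the taxicab metric. -/
theorem exists_taxicab_bisector_of_finite {A : Set (ℤ × ℤ)} (hA : A.Finite) :
    ∃ u v : ℤ × ℤ, u ≠ v ∧
      A ⊆ {x : ℤ × ℤ | |x.1 - u.1| + |x.2 - u.2| = |x.1 - v.1| + |x.2 - v.2|} := by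
  obtain ⟨⟨a, b⟩, hab⟩ := hA.bddAbove
  refine ⟨(a + 1, b), (a, b + 1), by simp, fun x hx => ?_⟩
  obtain ⟨h₁, h₂⟩ : x.1 ≤ a ∧ x.2 ≤ b := hab hx
  simp only [mem_ofPred_eq]
  rw [abs_of_nonpos (by lia), abs_of_nonpos (by lia), abs_of_nonpos (by lia),
    abs_of_nonpos (by lia)]
  ring

/-- If every finite set is contained in a bisector, then all `k`-metric dimensions with `1 ≤ k`
are infinite. -/
theorem kMetricDim_eq_top_of_finite_subset_bisector {X α : Type*} {ρ : X → X → α}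
    (h : ∀ A : Set X, A.Finite → ∃ u v, u ≠ v ∧ A ⊆ {x | ρ u x = ρ v x}) {k : ℕ} (hk : 1 ≤ k) :
    kMetricDim ρ k = ⊤ := by
  refine sInf_eq_top.2 ?_
  rintro _ ⟨S, hS, -⟩
  obtain ⟨u, v, huv, hsub⟩ := h S S.finite_toSet
  have hempty : {w ∈ (S : Set X) | ρ u w ≠ ρ v w} = ∅ :=
    eq_empty_of_forall_notMem fun w hw => hw.2 (hsub hw.1)
  have hle := hS u v huv
  rw [hempty, encard_empty, nonpos_iff_eq_zero, Nat.cast_eq_zero] at hle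
  lia

/-- Let `X = ℤ × ℤ` with the taxicab metric
`d((a,b),(c,e)) = |a−c| + |b−e|` (the graph metric of the Cayley graph of `ℤ²` with the
standard generators). Then every finite subset of `X` lies in some bisector `B(u|v)`;
consequently `dim_k(X) = ∞` for every positive integer `k`. -/
theorem int_lattice_dim_top :
    (∀ A : Set (ℤ × ℤ), A.Finite → ∃ u v : ℤ × ℤ, u ≠ v ∧
      A ⊆ {x : ℤ × ℤ | |x.1 - u.1| + |x.2 - u.2| = |x.1 - v.1| + |x.2 - v.2|}) ∧
    ∀ k : ℕ, 1 ≤ k →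
      kMetricDim (fun x y : ℤ × ℤ => |x.1 - y.1| + |x.2 - y.2|) k = ⊤ := by
  refine ⟨fun A hA => exists_taxicab_bisector_of_finite hA, fun k hk =>
    kMetricDim_eq_top_of_finite_subset_bisector (fun A hA => ?_) hk⟩
  obtain ⟨u, v, huv, hsub⟩ := exists_taxicab_bisector_of_finite hA
  refine ⟨u, v, huv, fun x hx => ?_⟩
  simpa only [mem_ofPred_eq, abs_sub_comm] using hsub hx
end
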